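/- For every τ < 0 there exists a constant C > 0 (depending only on τ, and in particular independent of j, h and w) with the following property. For every integer j ≥ 1, every real h ≥ 0, every real w > 2, every B ≥ 0, and every continuous function v : [w,∞) → ℝ with |v(t)| ≤ B·t^τ for all t ≥ w, define 𝓕(z) = e^{−jz²/2} ∫₀^∞ e^{−t² + 2t√j z} t^h dt, 𝓤(z) = e^{−jz²/2} ∫₀^∞ e^{−t² − 2t√j z} t^h dt, W(z) = 𝓕′(z)𝓤(z) − 𝓕(z)𝓤′(z), and u(z) = (𝓤(z)/W(z)) ∫_w^z 𝓕(t)·v(t)·t dt + (𝓕(z)/W(z)) ∫_z^∞ 𝓤(t)·v(t)·t dt. Then |u(z)| ≤ C·B·z^{2+τ} for all z ≥ w. -/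

import Mathlib

open MeasureTheory intervalIntegral

open Set Filter Topology

/-- The integral `∫₀^∞ exp (-t² + 2ta) t^h dt`, a multiple of a parabolic cylinder function. -/
noncomputable def gaussianMoment (h a : ℝ) : ℝ :=
  ∫ t in Ioi (0 : ℝ), Real.exp (-t ^ 2 + 2 * t * a) * t ^ h

lemma measurable_gaussianMoment_integrand (h a : ℝ) :
    Measurable fun t : ℝ => Real.exp (-t ^ 2 + 2 * t * a) * t ^ h :=
  (by fun_prop : Measurable fun t : ℝ => Real.exp (-t ^ 2 + 2 * t * a)).mul
    (measurable_id.pow_const h)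

lemma integrableOn_gaussianMoment {h : ℝ} (hh : 0 ≤ h) (a : ℝ) :
    IntegrableOn (fun t : ℝ => Real.exp (-t ^ 2 + 2 * t * a) * t ^ h) (Ioi 0) := by
  have hg := (integrableOn_rpow_mul_exp_neg_mul_sq (b := 1 / 2) (by norm_num)
    (by linarith : -1 < h)).const_mul (Real.exp (2 * a ^ 2))
  refine hg.mono' (measurable_gaussianMoment_integrand h a).aestronglyMeasurable ?_
  filter_upwards [ae_restrict_mem measurableSet_Ioi] with t ht
  have ht0 : (0 : ℝ) ≤ t ^ h := Real.rpow_nonneg (le_of_lt ht) h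
  rw [Real.norm_of_nonneg (by positivity), mul_left_comm, ← Real.exp_add, mul_comm]
  refine mul_le_mul_of_nonneg_left (Real.exp_le_exp.2 ?_) ht0
  nlinarith [sq_nonneg (t - 2 * a)]

lemma gaussianMoment_nonneg (h a : ℝ) : 0 ≤ gaussianMoment h a :=
  setIntegral_nonneg measurableSet_Ioi fun _ ht =>
    mul_nonneg (Real.exp_pos _).le (Real.rpow_nonneg (le_of_lt ht) h)

lemma monotone_gaussianMoment {h : ℝ} (hh : 0 ≤ h) : Monotone (gaussianMoment h) := by
  intro a b hab
  refine setIntegral_mono_on (integrableOn_gaussianMoment hh a) (integrableOn_gaussianMoment hh b)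
    measurableSet_Ioi fun t ht => ?_
  have ht0 : 0 < t := ht
  gcongr

lemma differentiable_gaussianMoment {h : ℝ} (hh : 0 ≤ h) :
    Differentiable ℝ (gaussianMoment h) := by
  intro a
  have key := hasDerivAt_integral_of_dominated_loc_of_deriv_le (𝕜 := ℝ)
    (μ := volume.restrict (Ioi (0 : ℝ)))
    (F := fun x t : ℝ => Real.exp (-t ^ 2 + 2 * t * x) * t ^ h)
    (F' := fun x t : ℝ => 2 * (Real.exp (-t ^ 2 + 2 * t * x) * t ^ (h + 1)))
    (bound := fun t : ℝ => 2 * (Real.exp (-t ^ 2 + 2 * t * (a + 1)) * t ^ (h + 1)))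
    (Iio_mem_nhds (by linarith : a < a + 1))
    (.of_forall fun x => (measurable_gaussianMoment_integrand h x).aestronglyMeasurable)
    (integrableOn_gaussianMoment hh a)
    ((measurable_gaussianMoment_integrand (h + 1) a).const_mul 2).aestronglyMeasurable
    ?_ ((integrableOn_gaussianMoment (by linarith) (a + 1)).const_mul 2) ?_
  · exact key.2.differentiableAt
  · filter_upwards [ae_restrict_mem measurableSet_Ioi] with t ht x hx
    have ht0 : 0 < t := ht
    have hx' : x ≤ a + 1 := le_of_lt hx
    rw [Real.norm_of_nonneg (by positivity)]
    gcongr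
  · filter_upwards [ae_restrict_mem measurableSet_Ioi] with t ht x _
    have ht0 : 0 < t := ht
    convert! ((((hasDerivAt_id x).const_mul (2 * t)).const_add (-t ^ 2)).exp.mul_const
      (t ^ h)) using 1
    rw [Real.rpow_add_one ht0.ne']
    simp only [id]
    ring

lemma exp_neg_sq_mul_gaussianMoment (h a : ℝ) :
    Real.exp (-a ^ 2) * gaussianMoment h a
      = ∫ t in Ioi (0 : ℝ), Real.exp (-(t - a) ^ 2) * t ^ h := by
  rw [gaussianMoment, ← MeasureTheory.integral_const_mul]
  congr 1 with t
  rw [← mul_assoc, ← Real.exp_add]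
  ring_nf

lemma monotone_exp_neg_sq_mul_gaussianMoment {h : ℝ} (hh : 0 ≤ h) :
    Monotone fun a => Real.exp (-a ^ 2) * gaussianMoment h a := by
  intro a b hab
  have hint : ∀ c : ℝ, IntegrableOn (fun t : ℝ => Real.exp (-(t - c) ^ 2) * t ^ h) (Ioi 0) := by
    intro c
    refine ((integrableOn_gaussianMoment hh c).const_mul (Real.exp (-c ^ 2))).congr
      (.of_forall fun t => ?_)
    simp only
    rw [← mul_assoc, ← Real.exp_add]
    ring_nf
  have hmp := measurePreserving_add_right (volume : Measure ℝ) (b - a)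
  have hemb : MeasurableEmbedding fun t : ℝ => t + (b - a) := measurableEmbedding_addRight (b - a)
  have hpre : (fun t : ℝ => t + (b - a)) ⁻¹' Ioi (b - a) = Ioi 0 := by
    ext t; simp
  have hsub : Ioi (b - a) ⊆ Ioi (0 : ℝ) := Ioi_subset_Ioi (by linarith)
  have hshift := hmp.setIntegral_preimage_emb hemb
    (fun t : ℝ => Real.exp (-(t - b) ^ 2) * t ^ h) (Ioi (b - a))
  have hshift_int := (hmp.integrableOn_comp_preimage hemb).2 ((hint b).mono_set hsub)
  rw [hpre] at hshift hshift_int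
  simp only [exp_neg_sq_mul_gaussianMoment]
  calc ∫ t in Ioi (0 : ℝ), Real.exp (-(t - a) ^ 2) * t ^ h
      ≤ ∫ t in Ioi (0 : ℝ), Real.exp (-(t + (b - a) - b) ^ 2) * (t + (b - a)) ^ h := by
        refine setIntegral_mono_on (hint a) hshift_int measurableSet_Ioi fun t ht => ?_
        have ht0 : 0 < t := ht
        rw [show t + (b - a) - b = t - a by ring]
        gcongr
        linarith
    _ = ∫ t in Ioi (b - a), Real.exp (-(t - b) ^ 2) * t ^ h := hshift
    _ ≤ ∫ t in Ioi (0 : ℝ), Real.exp (-(t - b) ^ 2) * t ^ h := by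
        refine setIntegral_mono_set (hint b) ?_ hsub.eventuallyLE
        filter_upwards [ae_restrict_mem measurableSet_Ioi] with t ht
        exact mul_nonneg (Real.exp_pos _).le (Real.rpow_nonneg (le_of_lt ht) h)

lemma two_mul_gaussianMoment_le_deriv {h : ℝ} (hh : 0 ≤ h) (a : ℝ) :
    2 * a * gaussianMoment h a ≤ deriv (gaussianMoment h) a := by
  have hE : HasDerivAt (fun x : ℝ => Real.exp (-x ^ 2)) (Real.exp (-a ^ 2) * -(2 * a)) a := by
    simpa using! ((hasDerivAt_pow 2 a).neg).exp
  have hn := (hE.mul (differentiable_gaussianMoment hh a).hasDerivAt).nonneg_of_monotone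
    (monotone_exp_neg_sq_mul_gaussianMoment hh)
  refine sub_nonneg.1 ((mul_nonneg_iff_of_pos_left (Real.exp_pos (-a ^ 2))).1 ?_)
  linarith

/-- On `t ≥ 1`, a negative power changes over `[t, z]` by at most a fraction of the Gaussian
weight. -/
lemma exists_rpow_mul_exp_le {τ : ℝ} (hτ : τ < 0) :
    ∃ C : ℝ, 0 < C ∧ ∀ t z : ℝ, 1 ≤ t → t ≤ z →
      t ^ τ * Real.exp (-(z ^ 2 - t ^ 2) / 4) ≤ C * z ^ τ := by
  set m := -τ / 2 with hm
  have hm0 : 0 < m := by linarith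
  refine ⟨Real.exp (1 / 4 + m * Real.log (4 * m)), Real.exp_pos _, fun t z ht htz => ?_⟩
  have ht0 : 0 < t := by linarith
  have hz0 : 0 < z := by linarith
  have hsq : t ^ 2 ≤ z ^ 2 := by gcongr
  have hx : 0 < 1 + (z ^ 2 - t ^ 2) := by linarith
  have hratio : z ^ 2 ≤ t ^ 2 * (1 + (z ^ 2 - t ^ 2)) := by
    nlinarith [mul_nonneg (by nlinarith : (0 : ℝ) ≤ t ^ 2 - 1) (sub_nonneg.2 hsq)]
  have hlog := Real.log_le_log (by positivity) hratio
  rw [Real.log_mul (by positivity) hx.ne', Real.log_pow, Real.log_pow] at hlog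
  have hlin := Real.log_le_sub_one_of_pos (div_pos hx (by linarith : 0 < 4 * m))
  rw [Real.log_div hx.ne' (by positivity)] at hlin
  have hmul := mul_le_mul_of_nonneg_left hlin hm0.le
  have hdiv : m * ((1 + (z ^ 2 - t ^ 2)) / (4 * m) - 1) = (1 + (z ^ 2 - t ^ 2)) / 4 - m := by
    field_simp
  rw [hdiv] at hmul
  have hmul' := mul_le_mul_of_nonneg_left hlog hm0.le
  rw [Real.rpow_def_of_pos ht0, Real.rpow_def_of_pos hz0, ← Real.exp_add, ← Real.exp_add,
    Real.exp_le_exp]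
  push_cast at hmul'
  have hτm : τ = -2 * m := by rw [hm]; ring
  rw [hτm]
  linarith

lemma intervalIntegral_mul_exp_le (w z : ℝ) :
    ∫ t in w..z, t * Real.exp (-(z ^ 2 - t ^ 2) / 4) ≤ 2 := by
  have hd : ∀ t ∈ uIcc w z, HasDerivAt (fun t : ℝ => 2 * Real.exp (-(z ^ 2 - t ^ 2) / 4))
      (t * Real.exp (-(z ^ 2 - t ^ 2) / 4)) t := by
    intro t _
    convert! ((((((hasDerivAt_id t).pow 2).const_sub (z ^ 2)).neg).div_const 4).exp.const_mul 2)
      using 1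
    simp
    ring
  rw [integral_eq_sub_of_hasDerivAt hd (Continuous.intervalIntegrable (by fun_prop) _ _)]
  have := Real.exp_pos (-(z ^ 2 - w ^ 2) / 4)
  rw [sub_self, neg_zero, zero_div, Real.exp_zero]
  linarith

lemma integral_Ioi_mul_exp {z : ℝ} (hz : 0 ≤ z) :
    IntegrableOn (fun t : ℝ => t * Real.exp (-(t ^ 2 - z ^ 2) / 2)) (Ioi z) ∧
      ∫ t in Ioi z, t * Real.exp (-(t ^ 2 - z ^ 2) / 2) = 1 := by
  have hd : ∀ t ∈ Ici z, HasDerivAt (fun t : ℝ => -Real.exp (-(t ^ 2 - z ^ 2) / 2))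
      (t * Real.exp (-(t ^ 2 - z ^ 2) / 2)) t := by
    intro t _
    convert! ((((((hasDerivAt_id t).pow 2).sub_const (z ^ 2)).neg).div_const 2).exp.neg) using 1
    simp
    ring
  have hpos : ∀ t ∈ Ioi z, 0 ≤ t * Real.exp (-(t ^ 2 - z ^ 2) / 2) := fun t ht =>
    mul_nonneg (hz.trans (le_of_lt ht)) (Real.exp_pos _).le
  have hlim : Tendsto (fun t : ℝ => -Real.exp (-(t ^ 2 - z ^ 2) / 2)) atTop (𝓝 0) := by
    rw [← neg_zero]
    refine (Real.tendsto_exp_atBot.comp ?_).neg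
    refine Tendsto.atBot_div_const two_pos (tendsto_neg_atTop_atBot.comp ?_)
    exact tendsto_atTop_add_const_right _ _ (tendsto_pow_atTop two_ne_zero)
  refine ⟨integrableOn_Ioi_deriv_of_nonneg' hd hpos hlim, ?_⟩
  rw [integral_Ioi_of_hasDerivAt_of_nonneg' hd hpos hlim]
  simp

/-- The case `j_k > 0` of Lemma B.3: the particular solution of
`u″ − (j²z² + λ)u = z·v(z)`, `λ = (2h+1)j`, built by variation of parameters from the
fundamental solutions `𝓕, 𝓤`, satisfies `|u(z)| ≤ C B z^{2+τ}` for `z ≥ w`, with `C`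
depending only on `τ` (independent of `j`, `h` and `w`). -/
theorem variation_of_parameters_uniform_bound (τ : ℝ) (hτ : τ < 0) :
    ∃ C : ℝ, 0 < C ∧
      ∀ (j : ℕ), 1 ≤ j → ∀ (h : ℝ), 0 ≤ h → ∀ w B : ℝ, 2 < w → 0 ≤ B →
      ∀ v : ℝ → ℝ, ContinuousOn v (Set.Ici w) →
      (∀ t, w ≤ t → |v t| ≤ B * t ^ τ) →
      ∀ F U : ℝ → ℝ,
      (∀ z, F z = Real.exp (-(j : ℝ) * z ^ 2 / 2) *
          ∫ t in Set.Ioi (0 : ℝ),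
            Real.exp (-t ^ 2 + 2 * t * (Real.sqrt (j : ℝ) * z)) * t ^ h) →
      (∀ z, U z = Real.exp (-(j : ℝ) * z ^ 2 / 2) *
          ∫ t in Set.Ioi (0 : ℝ),
            Real.exp (-t ^ 2 - 2 * t * (Real.sqrt (j : ℝ) * z)) * t ^ h) →
      ∀ z, w ≤ z →
        |U z / (deriv F z * U z - F z * deriv U z) * (∫ t in w..z, F t * v t * t) +
            F z / (deriv F z * U z - F z * deriv U z) *
              (∫ t in Set.Ioi z, U t * v t * t)|
          ≤ C * B * z ^ (2 + τ) := by
  obtain ⟨D, hD, hDbound⟩ := exists_rpow_mul_exp_le hτ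
  refine ⟨2 * D + 1, by linarith, ?_⟩
  intro j hj h hh w B hw hB v _ hvB F U hF hU z hwz
  have hj1 : (1 : ℝ) ≤ j := by exact_mod_cast hj
  set r : ℝ := Real.sqrt (j : ℝ)
  have hr0 : 0 ≤ r := Real.sqrt_nonneg _
  have hrr : r ^ 2 = (j : ℝ) := Real.sq_sqrt (by linarith)
  have hz2 : 2 < z := hw.trans_le hwz
  have hF' : ∀ x, F x = Real.exp (-(j : ℝ) * x ^ 2 / 2) * gaussianMoment h (r * x) := hF
  have hU' : ∀ x, U x = Real.exp (-(j : ℝ) * x ^ 2 / 2) * gaussianMoment h (-r * x) := by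
    intro x
    rw [hU, gaussianMoment]
    congr 2 with t
    ring_nf
  have hF0 : ∀ x, 0 ≤ F x := fun x => by
    rw [hF']; exact mul_nonneg (Real.exp_pos _).le (gaussianMoment_nonneg _ _)
  have hU0 : ∀ x, 0 ≤ U x := fun x => by
    rw [hU']; exact mul_nonneg (Real.exp_pos _).le (gaussianMoment_nonneg _ _)
  have hFle : ∀ t, 0 ≤ t → t ≤ z → F t ≤ F z * Real.exp (-(z ^ 2 - t ^ 2) / 2) := by
    intro t ht htz
    have hmono := monotone_exp_neg_sq_mul_gaussianMoment hh (mul_le_mul_of_nonneg_left htz hr0)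
    simp only [mul_pow, hrr] at hmono
    have hsq : t ^ 2 ≤ z ^ 2 := by gcongr
    calc F t = Real.exp (j * t ^ 2 / 2)
          * (Real.exp (-(j * t ^ 2)) * gaussianMoment h (r * t)) := by
          rw [hF', ← mul_assoc, ← Real.exp_add]; ring_nf
      _ ≤ Real.exp (j * t ^ 2 / 2)
          * (Real.exp (-(j * z ^ 2)) * gaussianMoment h (r * z)) := by gcongr
      _ = F z * Real.exp (-(j * (z ^ 2 - t ^ 2)) / 2) := by
          rw [hF', mul_right_comm, ← Real.exp_add, ← mul_assoc, ← Real.exp_add]; ring_nf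
      _ ≤ F z * Real.exp (-(z ^ 2 - t ^ 2) / 2) := by
          refine mul_le_mul_of_nonneg_left (Real.exp_le_exp.2 ?_) (hF0 z)
          nlinarith
  have hUle : ∀ t, z ≤ t → U t ≤ U z * Real.exp (-(t ^ 2 - z ^ 2) / 2) := by
    intro t htz
    have hmono := monotone_gaussianMoment hh
      (mul_le_mul_of_nonpos_left htz (by linarith : -r ≤ 0))
    have hsq : z ^ 2 ≤ t ^ 2 := by gcongr
    calc U t ≤ Real.exp (-(j : ℝ) * t ^ 2 / 2) * gaussianMoment h (-r * z) := by
          rw [hU']; gcongr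
      _ = U z * Real.exp (-(j * (t ^ 2 - z ^ 2)) / 2) := by
          rw [hU', mul_right_comm, ← Real.exp_add]; ring_nf
      _ ≤ U z * Real.exp (-(t ^ 2 - z ^ 2) / 2) := by
          refine mul_le_mul_of_nonneg_left (Real.exp_le_exp.2 ?_) (hU0 z)
          nlinarith
  have hderiv : ∀ c : ℝ, deriv
      (fun x => Real.exp (-(j : ℝ) * x ^ 2 / 2) * gaussianMoment h (c * x)) z
      = Real.exp (-(j : ℝ) * z ^ 2 / 2)
        * (c * deriv (gaussianMoment h) (c * z) - j * z * gaussianMoment h (c * z)) := by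
    intro c
    have h1 := ((((hasDerivAt_id z).pow 2).const_mul (-(j : ℝ))).div_const 2).exp
    have h2 := (differentiable_gaussianMoment hh (c * z)).hasDerivAt.comp z
      ((hasDerivAt_id z).const_mul c)
    refine Eq.trans (h1.mul h2).deriv ?_
    simp
    ring
  have hW : F z * U z ≤ 1 * (deriv F z * U z - F z * deriv U z) := by
    rw [funext hF', funext hU', hderiv, hderiv]
    have hd1 := two_mul_gaussianMoment_le_deriv hh (r * z)
    have hd2 : 0 ≤ deriv (gaussianMoment h) (-r * z) := (monotone_gaussianMoment hh).deriv_nonneg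
    have hp := gaussianMoment_nonneg h (r * z)
    have hq := gaussianMoment_nonneg h (-r * z)
    set p := gaussianMoment h (r * z)
    set q := gaussianMoment h (-r * z)
    set p' := deriv (gaussianMoment h) (r * z)
    set q' := deriv (gaussianMoment h) (-r * z)
    set E := Real.exp (-(j : ℝ) * z ^ 2 / 2)
    have h1 : 2 * (j : ℝ) * z * p * q ≤ r * p' * q := by
      rw [← hrr]
      calc 2 * r ^ 2 * z * p * q = r * (2 * (r * z) * p) * q := by ring
        _ ≤ r * p' * q := by gcongr
    have h2 : p * q ≤ 2 * (j : ℝ) * z * p * q := by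
      have : 1 ≤ 2 * (j : ℝ) * z := by nlinarith
      calc p * q = 1 * (p * q) := by ring
        _ ≤ (2 * (j : ℝ) * z) * (p * q) := by gcongr
        _ = _ := by ring
    have h3 : 0 ≤ r * p * q' := by positivity
    calc E * p * (E * q) = E ^ 2 * (p * q) := by ring
      _ ≤ E ^ 2 * (r * p' * q + r * p * q') := by gcongr; linarith
      _ = _ := by ring
  set W := deriv F z * U z - F z * deriv U z
  have hW0 : 0 ≤ W := by linarith [mul_nonneg (hF0 z) (hU0 z)]
  have hG : F z * U z / W ≤ 1 := div_le_of_le_mul₀ hW0 zero_le_one hW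
  have hzτ : 0 ≤ z ^ τ := Real.rpow_nonneg (by linarith) _
  have hI : |∫ t in w..z, F t * v t * t| ≤ F z * B * D * z ^ τ * 2 := by
    refine (intervalIntegral.norm_integral_le_of_norm_le (μ := volume)
      (f := fun t => F t * v t * t) (g := fun t => F z * B * D * z ^ τ
      * (t * Real.exp (-(z ^ 2 - t ^ 2) / 4))) hwz (.of_forall fun t ht => ?_)
      (Continuous.intervalIntegrable (by fun_prop) _ _)).trans ?_
    · have ht2 : 2 < t := hw.trans ht.1
      have hsplit : Real.exp (-(z ^ 2 - t ^ 2) / 2)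
          = Real.exp (-(z ^ 2 - t ^ 2) / 4) * Real.exp (-(z ^ 2 - t ^ 2) / 4) := by
        rw [← Real.exp_add]; ring_nf
      have hFt := hFle t (by linarith) ht.2
      rw [hsplit] at hFt
      have hτt := hDbound t z (by linarith) ht.2
      have hfz := hF0 z
      have htτ : 0 ≤ t ^ τ := Real.rpow_nonneg (by linarith) _
      rw [norm_mul, norm_mul, Real.norm_of_nonneg (hF0 t), Real.norm_eq_abs,
        Real.norm_of_nonneg (by linarith : 0 ≤ t)]
      set e := Real.exp (-(z ^ 2 - t ^ 2) / 4)
      have he : 0 ≤ e := (Real.exp_pos _).le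
      calc F t * |v t| * t ≤ F z * (e * e) * (B * t ^ τ) * t := by
            gcongr
            exact hvB t ht.1.le
        _ = F z * B * e * t * (t ^ τ * e) := by ring
        _ ≤ F z * B * e * t * (D * z ^ τ) := by gcongr
        _ = _ := by ring
    · rw [intervalIntegral.integral_const_mul]
      have hfz := hF0 z
      gcongr
      exact intervalIntegral_mul_exp_le w z
  have hJ : |∫ t in Ioi z, U t * v t * t| ≤ U z * B * z ^ τ := by
    obtain ⟨hint, hval⟩ := integral_Ioi_mul_exp (by linarith : 0 ≤ z)
    rw [← Real.norm_eq_abs]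
    refine (MeasureTheory.norm_integral_le_of_norm_le (hint.const_mul (U z * B * z ^ τ)) ?_).trans
      (by rw [MeasureTheory.integral_const_mul, hval, mul_one])
    filter_upwards [ae_restrict_mem measurableSet_Ioi] with t ht
    have hzt : z < t := ht
    have hUt := hUle t hzt.le
    have huz := hU0 z
    have hτt : t ^ τ ≤ z ^ τ := Real.rpow_le_rpow_of_nonpos (by linarith) hzt.le hτ.le
    rw [norm_mul, norm_mul, Real.norm_of_nonneg (hU0 t), Real.norm_eq_abs,
      Real.norm_of_nonneg (by linarith : 0 ≤ t)]
    calc U t * |v t| * t ≤ U z * Real.exp (-(t ^ 2 - z ^ 2) / 2) * (B * z ^ τ) * t := by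
          have ht0 : 0 ≤ t := by linarith
          have hvt : |v t| ≤ B * z ^ τ := (hvB t (hwz.trans hzt.le)).trans (by gcongr)
          gcongr
      _ = _ := by ring
  have hA : 0 ≤ U z / W := div_nonneg (hU0 z) hW0
  have hC : 0 ≤ F z / W := div_nonneg (hF0 z) hW0
  calc |U z / W * (∫ t in w..z, F t * v t * t) + F z / W * ∫ t in Ioi z, U t * v t * t|
      ≤ U z / W * (F z * B * D * z ^ τ * 2) + F z / W * (U z * B * z ^ τ) := by
        refine (abs_add_le _ _).trans (add_le_add ?_ ?_)
        · rw [abs_mul, abs_of_nonneg hA]; gcongr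
        · rw [abs_mul, abs_of_nonneg hC]; gcongr
    _ = F z * U z / W * ((2 * D + 1) * B * z ^ τ) := by ring
    _ ≤ 1 * ((2 * D + 1) * B * z ^ τ) := by gcongr
    _ ≤ z ^ 2 * ((2 * D + 1) * B * z ^ τ) := by gcongr; nlinarith
    _ = (2 * D + 1) * B * z ^ (2 + τ) := by
        rw [Real.rpow_add (by linarith), Real.rpow_two]; ring
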